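/- Let τ ∈ ℂ with Im τ > 0, q := e^{2πiτ}. Define M(u) := 4π² i q^{1/8} (q;q)_∞³ μ(u,u), where μ is Zwegers' μ-function and q^{1/8} := e^{πiτ/4}. Then for all u, v ∈ ℂ∖(ℤ+ℤτ), the Weierstrass ℘-function for the lattice ℤ+ℤτ satisfies ℘(u) − ℘(v) = M(u) − M(v). -/

import Mathlib

noncomputable section

/-- `e z = exp(2πiz)`. -/
def e (z : ℂ) : ℂ := Complex.exp (2 * (Real.pi : ℂ) * Complex.I * z)

/-- Infinite q-Pochhammer symbol `(a;q)_∞`. -/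
def qpinf (a q : ℂ) : ℂ := ∏' j : ℕ, (1 - a * q ^ j)

/-- `(a;q)_n` for `n : ℤ`, defined as `(a;q)_∞ / (a q^n;q)_∞`. -/
def qpint (a q : ℂ) (n : ℤ) : ℂ := qpinf a q / qpinf (a * q ^ n) q

/-- `θ(x) = (x;q)_∞ (q/x;q)_∞`. -/
def qtheta (q x : ℂ) : ℂ := qpinf x q * qpinf (q / x) q

/-- Weierstrass ℘-function for the lattice ℤ+ℤτ. -/
def wp (τ u : ℂ) : ℂ :=
  1 / u ^ 2 + ∑' p : ℤ × ℤ,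
    if p = (0, 0) then 0
    else 1 / (u - ((p.1 : ℂ) + (p.2 : ℂ) * τ)) ^ 2 - 1 / ((p.1 : ℂ) + (p.2 : ℂ) * τ) ^ 2

/-- Jacobi theta `ϑ₁₁(v) = -i q^{1/8} e^{-πiv} (q;q)_∞ θ(e^{2πiv})`. -/
def theta11 (τ v : ℂ) : ℂ :=
  -Complex.I * e (τ / 8) * e (-v / 2) * qpinf (e τ) (e τ) * qtheta (e τ) (e v)

/-- Zwegers' μ-function. -/
def zMu (τ u v : ℂ) : ℂ :=
  e (u / 2) / theta11 τ v *
    ∑' n : ℤ, (-1 : ℂ) ^ n * e ((n : ℂ) * v) * (e τ) ^ ((n * (n + 1)) / 2) /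
      (1 - e u * (e τ) ^ n)

open Complex Filter Topology Asymptotics
open scoped PeriodPair

/-- An even function, holomorphic on a punctured neighbourhood of `0` and `o(u⁻²)` there, has a
limit at `0`. -/
lemma exists_tendsto_of_even {G : ℂ → ℂ} (hd : ∀ᶠ u in 𝓝[≠] (0 : ℂ), DifferentiableAt ℂ G u)
    (heven : ∀ᶠ u in 𝓝[≠] (0 : ℂ), G (-u) = G u)
    (ho : Tendsto (fun u ↦ u ^ 2 * G u) (𝓝[≠] 0) (𝓝 0)) :
    ∃ c, Tendsto G (𝓝[≠] 0) (𝓝 c) := by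
  have hne : ∀ᶠ u in 𝓝[≠] (0 : ℂ), u ≠ 0 := eventually_mem_nhdsWithin
  have hp : Tendsto (fun u ↦ u * G u) (𝓝[≠] 0) (𝓝 (limUnder (𝓝[≠] 0) fun u ↦ u * G u)) := by
    refine tendsto_limUnder_of_differentiable_on_punctured_nhds_of_isLittleO ?_ ?_
    · filter_upwards [hd] with u hu
      fun_prop
    · refine (isLittleO_iff_tendsto' ?_).2 ?_
      · filter_upwards [hne] with u hu h
        simp_all
      · refine ho.congr fun u ↦ ?_
        simp
        ring
  set p := limUnder (𝓝[≠] 0) fun u ↦ u * G u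
  have hneg : Tendsto (fun u : ℂ ↦ -u) (𝓝[≠] 0) (𝓝[≠] 0) := by
    refine tendsto_nhdsWithin_of_tendsto_nhds_of_eventually_within _ ?_ ?_
    · exact (Continuous.tendsto' (by fun_prop) _ _ (by simp)).mono_left nhdsWithin_le_nhds
    · filter_upwards [hne] with u hu
      simpa using hu
  have hp0 : p = 0 := by
    have h1 : Tendsto (fun u ↦ u * G u) (𝓝[≠] 0) (𝓝 (-p)) := by
      refine (hp.comp hneg).neg.congr' ?_
      filter_upwards [heven] with u hu
      simp [hu]
    have := tendsto_nhds_unique hp h1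
    exact self_eq_neg.1 this
  rw [hp0] at hp
  refine ⟨_, tendsto_limUnder_of_differentiable_on_punctured_nhds_of_isLittleO hd ?_⟩
  refine (isLittleO_iff_tendsto' ?_).2 ?_
  · filter_upwards [hne] with u hu h
    simp_all
  · have h2 : Tendsto (fun u : ℂ ↦ u * G 0) (𝓝[≠] 0) (𝓝 0) :=
      (Continuous.tendsto' (by fun_prop) _ _ (by simp)).mono_left nhdsWithin_le_nhds
    have := hp.sub h2
    rw [sub_zero] at this
    refine this.congr fun u ↦ ?_
    simp
    ring

/-- Liouville's theorem for even elliptic functions, holomorphic off the lattice, with at most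
a simple pole at the lattice points. -/
lemma PeriodPair.apply_eq_apply_of_even (L : PeriodPair) {G : ℂ → ℂ}
    (hd : ∀ u ∉ L.lattice, DifferentiableAt ℂ G u)
    (hper : ∀ u ∉ L.lattice, ∀ l ∈ L.lattice, G (u + l) = G u)
    (heven : ∀ u ∉ L.lattice, G (-u) = G u)
    (ho : Tendsto (fun u ↦ u ^ 2 * G u) (𝓝[≠] 0) (𝓝 0))
    {u v : ℂ} (hu : u ∉ L.lattice) (hv : v ∉ L.lattice) : G u = G v := by
  classical
  have hev : ∀ l : ℂ, ∀ᶠ u in 𝓝[≠] l, u ∉ L.lattice := fun l ↦ by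
    rw [eventually_nhdsWithin_iff]
    filter_upwards [L.compl_lattice_sdiff_singleton_mem_nhds l] with w hw hw' h
    exact hw ⟨h, hw'⟩
  obtain ⟨c, hc⟩ := exists_tendsto_of_even ((hev 0).mono hd) ((hev 0).mono heven) ho
  set H : ℂ → ℂ := fun w ↦ if w ∈ L.lattice then c else G w with hH
  have hHper : ∀ w, ∀ l ∈ L.lattice, H (w + l) = H w := fun w l hl ↦ by
    by_cases hw : w ∈ L.lattice
    · simp [hH, hw, add_mem hw hl]
    · have : w + l ∉ L.lattice := fun h ↦ hw (by simpa using sub_mem h hl)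
      simp [hH, hw, this, hper w hw l hl]
  have hHd' : ∀ w ∉ L.lattice, DifferentiableAt ℂ H w := fun w hw ↦ by
    refine (hd w hw).congr_of_eventuallyEq ?_
    filter_upwards [L.isClosed_lattice.isOpen_compl.mem_nhds hw] with z hz
    exact if_neg hz
  have hH0 : DifferentiableAt ℂ H 0 := by
    refine (analyticAt_of_differentiable_on_punctured_nhds_of_continuousAt
      ((hev 0).mono hHd') ?_).differentiableAt
    rw [continuousAt_iff_punctured_nhds]
    have : H 0 = c := if_pos (zero_mem _)
    rw [this]
    refine hc.congr' ?_
    filter_upwards [hev 0] with z hz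
    exact (if_neg hz).symm
  have hHd : Differentiable ℂ H := fun w ↦ by
    by_cases hw : w ∈ L.lattice
    · have : H = fun z ↦ H (z + -w) := funext fun z ↦ (hHper z _ (neg_mem hw)).symm
      rw [this]
      refine DifferentiableAt.comp (f := fun z ↦ z + -w) (g := H) w ?_ (by fun_prop)
      simpa using hH0
    · exact hHd' w hw
  have hb : Bornology.IsBounded (Set.range H) := by
    have hK : IsCompact (closure (ZSpan.fundamentalDomain L.basis)) :=
      (ZSpan.fundamentalDomain_isBounded L.basis).isCompact_closure
    refine ((hK.image hHd.continuous).isBounded).subset ?_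
    rintro _ ⟨w, rfl⟩
    refine ⟨ZSpan.fract L.basis w,
      subset_closure (ZSpan.fract_mem_fundamentalDomain L.basis w), ?_⟩
    rw [ZSpan.fract_apply, sub_eq_add_neg]
    refine hHper w _ (neg_mem ?_)
    rw [L.lattice_eq_span_range_basis]
    exact (ZSpan.floor L.basis w).2
  have := hHd.apply_eq_apply_of_bounded hb u v
  simpa [hH, hu, hv] using this

/-- The period pair `(1, τ)`. -/
def periodPairOne (τ : ℂ) (hτ : 0 < τ.im) : PeriodPair where
  ω₁ := 1
  ω₂ := τ
  indep := by
    rw [LinearIndependent.pair_iff]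
    intro s t h
    have him := congrArg Complex.im h
    have hre := congrArg Complex.re h
    simp at him hre
    rcases him with rfl | h0
    · simpa using hre
    · exact absurd h0 hτ.ne'

lemma mem_lattice_periodPairOne {τ : ℂ} (hτ : 0 < τ.im) {u : ℂ} :
    u ∈ (periodPairOne τ hτ).lattice ↔ ∃ m n : ℤ, u = m + n * τ := by
  simp [PeriodPair.mem_lattice, periodPairOne, eq_comm]

lemma wp_eq (τ : ℂ) (hτ : 0 < τ.im) (u : ℂ) :
    wp τ u = 1 / u ^ 2 + (periodPairOne τ hτ).weierstrassPExcept 0 u := by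
  rw [wp, PeriodPair.weierstrassPExcept,
    ← (periodPairOne τ hτ).latticeEquivProd.symm.toEquiv.tsum_eq]
  congr 1
  refine tsum_congr fun p ↦ ?_
  have h : ((periodPairOne τ hτ).latticeEquivProd.symm p : ℂ) = p.1 + p.2 * τ := by
    rw [PeriodPair.latticeEquiv_symm_apply]
    simp [periodPairOne]
  have h0 : ((periodPairOne τ hτ).latticeEquivProd.symm p : ℂ) = 0 ↔ p = (0, 0) := by
    simp [Prod.ext_iff]
  simp only [LinearEquiv.coe_toEquiv, h0]
  simp only [h]

lemma wp_eq_weierstrassP (τ : ℂ) (hτ : 0 < τ.im) (u : ℂ) :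
    wp τ u = (periodPairOne τ hτ).weierstrassP u := by
  have := (periodPairOne τ hτ).weierstrassPExcept_add 0 u
  simp only [ZeroMemClass.coe_zero] at this
  rw [wp_eq τ hτ, ← this]
  simp
  ring

lemma tendsto_sq_mul_wp (τ : ℂ) (hτ : 0 < τ.im) :
    Tendsto (fun u ↦ u ^ 2 * wp τ u) (𝓝[≠] 0) (𝓝 1) := by
  have hc : ContinuousAt ((periodPairOne τ hτ).weierstrassPExcept 0) 0 :=
    (((periodPairOne τ hτ).differentiableOn_weierstrassPExcept 0).differentiableAt
      ((periodPairOne τ hτ).compl_lattice_sdiff_singleton_mem_nhds 0)).continuousAt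
  have h : ContinuousAt
      (fun u ↦ 1 + u ^ 2 * (periodPairOne τ hτ).weierstrassPExcept 0 u) 0 := by fun_prop
  have h2 := h.tendsto.mono_left (nhdsWithin_le_nhds (s := {0}ᶜ))
  simp only [ne_eq, OfNat.ofNat_ne_zero, not_false_eq_true, zero_pow, zero_mul, add_zero] at h2
  refine h2.congr' ?_
  filter_upwards [eventually_mem_nhdsWithin] with u hu
  have hu : u ≠ 0 := hu
  rw [wp_eq τ hτ]
  field_simp

lemma e_add (u v : ℂ) : e (u + v) = e u * e v := by
  simp only [e, mul_add, Complex.exp_add]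

lemma e_neg (u : ℂ) : e (-u) = (e u)⁻¹ := by
  simp only [e, mul_neg, Complex.exp_neg]

lemma e_zero : e 0 = 1 := by simp [e]

lemma e_one : e 1 = 1 := by simp [e, Complex.exp_two_pi_mul_I]

lemma e_ne_zero (u : ℂ) : e u ≠ 0 := Complex.exp_ne_zero _

lemma e_int_mul (n : ℤ) (u : ℂ) : e (n * u) = e u ^ n := by
  rw [e, e, ← Complex.exp_int_mul]
  ring_nf

lemma norm_e (u : ℂ) : ‖e u‖ = Real.exp (-(2 * Real.pi * u.im)) := by
  simp [e, Complex.norm_exp]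

lemma e_eq_one_iff (u : ℂ) : e u = 1 ↔ ∃ n : ℤ, u = n := by
  rw [e, Complex.exp_eq_one_iff]
  refine exists_congr fun n ↦ ?_
  rw [mul_comm, mul_left_inj' (by simp [Real.pi_ne_zero])]

@[fun_prop]
lemma differentiable_e : Differentiable ℂ e := by
  unfold e
  fun_prop

lemma norm_e_lt_one {τ : ℂ} (hτ : 0 < τ.im) : ‖e τ‖ < 1 := by
  rw [norm_e, Real.exp_lt_one_iff]
  have := Real.pi_pos
  simp
  positivity

lemma one_sub_e_mul_zpow_ne_zero {τ u : ℂ} {k : ℤ} (h : ∀ m : ℤ, u ≠ m + (-k : ℤ) * τ) :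
    1 - e u * e τ ^ k ≠ 0 := by
  rw [sub_ne_zero, ← e_int_mul, ← e_add, ne_comm, Ne, e_eq_one_iff]
  rintro ⟨m, hm⟩
  refine h m ?_
  push_cast
  linear_combination hm

lemma summable_norm_mul_pow {q : ℂ} (hq : ‖q‖ < 1) (a : ℂ) :
    Summable fun j : ℕ ↦ ‖-(a * q ^ j)‖ := by
  simp only [norm_neg, norm_mul, norm_pow]
  exact (summable_geometric_of_lt_one (norm_nonneg _) hq).mul_left _

lemma qpinf_ne_zero {q a : ℂ} (hq : ‖q‖ < 1) (h : ∀ j : ℕ, 1 - a * q ^ j ≠ 0) :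
    qpinf a q ≠ 0 := by
  have := tprod_one_add_ne_zero_of_summable (f := fun j : ℕ ↦ -(a * q ^ j))
    (by simpa only [← sub_eq_add_neg] using h) (summable_norm_mul_pow hq a)
  rw [qpinf]
  simpa only [← sub_eq_add_neg] using this

lemma qpinf_eq_mul {q : ℂ} (hq : ‖q‖ < 1) (a : ℂ) :
    qpinf a q = (1 - a) * qpinf (a * q) q := by
  have h := multipliable_one_add_of_summable (summable_norm_mul_pow hq (a * q))
  have hj : ∀ j : ℕ, a * q ^ (j + 1) = a * q * q ^ j := fun j ↦ by ring
  have h' : Multipliable fun j : ℕ ↦ 1 - a * q ^ (j + 1) := by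
    simpa only [hj, sub_eq_add_neg] using h
  have := tprod_eq_zero_mul' (f := fun j : ℕ ↦ 1 - a * q ^ j) h'
  rw [qpinf, qpinf]
  simpa only [hj, pow_zero, mul_one] using this

lemma differentiable_qpinf {q : ℂ} (hq : ‖q‖ < 1) : Differentiable ℂ fun a ↦ qpinf a q := by
  intro a
  have ha : a ∈ Metric.ball (0 : ℂ) (‖a‖ + 1) := by simp
  have h := Summable.hasProdLocallyUniformlyOn_nat_one_add (f := fun (j : ℕ) a ↦ -(a * q ^ j))
    (K := Metric.ball (0 : ℂ) (‖a‖ + 1))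
    Metric.isOpen_ball ((summable_geometric_of_lt_one (norm_nonneg q) hq).mul_left (‖a‖ + 1))
    (.of_forall fun j x hx ↦ by
      simp only [norm_neg, norm_mul, norm_pow]
      have : ‖x‖ ≤ ‖a‖ + 1 := by simpa using (Metric.mem_ball.1 hx).le
      gcongr)
    (fun j ↦ by fun_prop)
  have h2 := h.differentiableOn (.of_forall fun s ↦ by
    simpa [Finset.prod_fn] using DifferentiableOn.finsetProd (fun _ _ ↦ by fun_prop))
      Metric.isOpen_ball
  have h3 := h2.differentiableAt (Metric.isOpen_ball.mem_nhds ha)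
  simp only [← sub_eq_add_neg] at h3
  exact h3

lemma qpinf_self_ne_zero {τ : ℂ} (hτ : 0 < τ.im) : qpinf (e τ) (e τ) ≠ 0 := by
  refine qpinf_ne_zero (norm_e_lt_one hτ) fun j h ↦ ?_
  have h1 : ‖e τ ^ (j + 1)‖ < 1 := by
    rw [norm_pow]
    exact pow_lt_one₀ (norm_nonneg _) (norm_e_lt_one hτ) (by simp)
  rw [pow_succ', ← sub_eq_zero.1 h] at h1
  simp at h1

lemma qtheta_add {τ : ℂ} (hτ : 0 < τ.im) (u : ℂ) :
    qtheta (e τ) (e (u + τ)) = -(e u)⁻¹ * qtheta (e τ) (e u) := by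
  have hq := norm_e_lt_one hτ
  have h0 := e_ne_zero u
  have h1 := e_ne_zero τ
  have h2 : e τ / (e u * e τ) = (e u)⁻¹ := by field_simp
  rw [qtheta, qtheta, e_add, h2, qpinf_eq_mul hq (e u), qpinf_eq_mul hq (e u)⁻¹,
    inv_mul_eq_div (e u) (e τ)]
  field_simp
  ring

lemma qtheta_neg {τ : ℂ} (hτ : 0 < τ.im) (u : ℂ) :
    qtheta (e τ) (e (-u)) = -(e u)⁻¹ * qtheta (e τ) (e u) := by
  have h1 := e_ne_zero τ
  have h0 := e_ne_zero u
  rw [← qtheta_add hτ, qtheta, qtheta, e_add, e_neg, div_inv_eq_mul, mul_comm (e τ), mul_comm]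
  congr 2
  field_simp

lemma qtheta_e_eq {τ : ℂ} (hτ : 0 < τ.im) (u : ℂ) :
    qtheta (e τ) (e u) = (1 - e u) * (qpinf (e (u + τ)) (e τ) * qpinf (e (τ - u)) (e τ)) := by
  rw [qtheta, qpinf_eq_mul (norm_e_lt_one hτ), sub_eq_add_neg τ, e_add, e_add, e_neg]
  ring_nf

lemma differentiable_qtheta_e {τ : ℂ} (hτ : 0 < τ.im) :
    Differentiable ℂ fun u ↦ qtheta (e τ) (e u) := by
  have h := differentiable_qpinf (norm_e_lt_one hτ)
  have h1 : Differentiable ℂ fun u ↦ qpinf (e (u + τ)) (e τ) :=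
    h.comp (f := fun u ↦ e (u + τ)) (by fun_prop)
  have h2 : Differentiable ℂ fun u ↦ qpinf (e (τ - u)) (e τ) :=
    h.comp (f := fun u ↦ e (τ - u)) (by fun_prop)
  simp only [qtheta_e_eq hτ]
  fun_prop

lemma qtheta_e_ne_zero {τ u : ℂ} (hτ : 0 < τ.im) (hu : ∀ m n : ℤ, u ≠ m + n * τ) :
    qtheta (e τ) (e u) ≠ 0 := by
  refine mul_ne_zero (qpinf_ne_zero (norm_e_lt_one hτ) fun j ↦ ?_)
    (qpinf_ne_zero (norm_e_lt_one hτ) fun j ↦ ?_)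
  · exact_mod_cast one_sub_e_mul_zpow_ne_zero (k := j) fun m ↦ hu m _
  · have := one_sub_e_mul_zpow_ne_zero (u := -u) (τ := τ) (k := j + 1) fun m h ↦
      hu (-m) (j + 1) (by push_cast at h ⊢; linear_combination -h)
    rw [e_neg, zpow_add_one₀ (e_ne_zero τ)] at this
    convert this using 2
    rw [zpow_natCast]
    ring

/-- The summand of the Appell–Lerch series in `zMu τ u u`. -/
def muTerm (τ : ℂ) (n : ℤ) (u : ℂ) : ℂ :=
  (-1 : ℂ) ^ n * e ((n : ℂ) * u) * (e τ) ^ ((n * (n + 1)) / 2) / (1 - e u * (e τ) ^ n)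

lemma two_mul_triangle (n : ℤ) : 2 * (n * (n + 1) / 2) = n * (n + 1) :=
  Int.mul_ediv_cancel' (Int.even_mul_succ_self n).two_dvd

lemma triangle_pred (n : ℤ) : (n - 1) * (n - 1 + 1) / 2 = n * (n + 1) / 2 - n := by
  have h1 := two_mul_triangle n
  have h2 := two_mul_triangle (n - 1)
  linarith

lemma triangle_neg (n : ℤ) : -n * (-n + 1) / 2 = n * (n + 1) / 2 - n := by
  have h1 := two_mul_triangle n
  have h2 := two_mul_triangle (-n)
  linarith

lemma muTerm_add (τ u : ℂ) (n : ℤ) :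
    muTerm τ (n - 1) (u + τ) = -(e u * e τ)⁻¹ * muTerm τ n u := by
  have h0 := e_ne_zero u
  have h1 := e_ne_zero τ
  rw [muTerm, muTerm, triangle_pred, e_int_mul, e_int_mul, e_add, mul_zpow,
    zpow_sub_one₀ h0, zpow_sub_one₀ h1, zpow_sub₀ h1, zpow_sub_one₀ (by norm_num)]
  have h2 : e u * e τ * (e τ ^ n * (e τ)⁻¹) = e u * e τ ^ n := by field_simp
  have h3 : e τ ^ n ≠ 0 := zpow_ne_zero _ h1
  rw [h2]
  field_simp

lemma muTerm_neg (τ u : ℂ) (n : ℤ) : muTerm τ (-n) (-u) = -e u * muTerm τ n u := by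
  have h0 := e_ne_zero u
  have h1 := e_ne_zero τ
  have h3 : e τ ^ n ≠ 0 := zpow_ne_zero _ h1
  have h4 : e u ^ n ≠ 0 := zpow_ne_zero _ h0
  rw [muTerm, muTerm, triangle_neg, e_int_mul, e_int_mul, e_neg, zpow_neg, zpow_neg, zpow_neg,
    inv_zpow, inv_inv, zpow_sub₀ h1, ← inv_zpow, inv_neg_one]
  have h2 : 1 - (e u)⁻¹ * (e τ ^ n)⁻¹ = -(1 - e u * e τ ^ n) * (e u * e τ ^ n)⁻¹ := by
    field_simp
    ring
  rw [h2]
  field_simp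

lemma muTerm_add_one (τ u : ℂ) (n : ℤ) : muTerm τ n (u + 1) = muTerm τ n u := by
  rw [muTerm, muTerm, e_int_mul, e_int_mul, e_add, e_one, mul_one]

lemma norm_muTerm_numerator (τ u : ℂ) (n : ℤ) :
    ‖(-1 : ℂ) ^ n * e ((n : ℂ) * u) * (e τ) ^ ((n * (n + 1)) / 2)‖ =
      ‖jacobiTheta₂_term n (u + τ / 2) τ‖ := by
  have h : (2 : ℂ) * ((n * (n + 1) / 2 : ℤ) : ℂ) = n * (n + 1) := by
    exact_mod_cast two_mul_triangle n
  rw [mul_assoc, norm_mul, norm_zpow, norm_neg, norm_one, one_zpow, one_mul, ← e_int_mul, ← e_add,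
    e, jacobiTheta₂_term]
  congr 2
  linear_combination Real.pi * I * τ * h

/-- On a horizontal strip, all but finitely many of the `muTerm`s are dominated by a summable
sequence. -/
lemma exists_muTerm_bound {τ : ℂ} (hτ : 0 < τ.im) (S : ℝ) :
    ∃ (t : Finset ℤ) (b : ℤ → ℝ), Summable b ∧ ∀ u : ℂ, |u.im| < S → ∀ n ∉ t,
      1 - e u * e τ ^ n ≠ 0 ∧ ‖muTerm τ n u‖ ≤ b n := by
  obtain ⟨N, hN⟩ := exists_nat_ge ((S + 1) / τ.im)
  rw [div_le_iff₀ hτ] at hN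
  have hb := summable_pow_mul_jacobiTheta₂_term_bound (S + τ.im) hτ 0
  simp only [pow_zero, one_mul] at hb
  refine ⟨Finset.Icc (-N : ℤ) N, _, hb.mul_left 2, fun u hu n hn ↦ ?_⟩
  rw [abs_lt] at hu
  have hpi := Real.pi_gt_three
  have hnorm : ‖e u * e τ ^ n‖ = Real.exp (-(2 * Real.pi * (u.im + n * τ.im))) := by
    rw [← e_int_mul, ← e_add, norm_e]
    simp
  have hden : 1 / 2 ≤ ‖1 - e u * e τ ^ n‖ := by
    rw [Finset.mem_Icc, not_and_or, not_le, not_le] at hn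
    rcases hn with hn | hn
    · have hn' : (n : ℝ) ≤ -N := by exact_mod_cast hn.le
      have h1 : u.im + n * τ.im ≤ -1 := by nlinarith
      have h2 : (2 : ℝ) ≤ ‖e u * e τ ^ n‖ := by
        rw [hnorm]
        nlinarith [Real.add_one_le_exp (-(2 * Real.pi * (u.im + n * τ.im)))]
      have h3 := norm_sub_norm_le (e u * e τ ^ n) 1
      rw [norm_sub_rev, norm_one] at h3
      linarith
    · have hn' : (N : ℝ) ≤ n := by exact_mod_cast hn.le
      have h1 : 1 ≤ u.im + n * τ.im := by nlinarith
      have h2 : ‖e u * e τ ^ n‖ ≤ 1 / 2 := by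
        rw [hnorm, Real.exp_neg, one_div]
        refine inv_anti₀ two_pos ?_
        nlinarith [Real.add_one_le_exp (2 * Real.pi * (u.im + n * τ.im))]
      have h3 := norm_sub_norm_le 1 (e u * e τ ^ n)
      rw [norm_one] at h3
      linarith
  refine ⟨fun h ↦ by norm_num [h] at hden, ?_⟩
  rw [muTerm, norm_div, norm_muTerm_numerator, div_le_iff₀ (by linarith)]
  have him : |(u + τ / 2).im| ≤ S + τ.im := by
    have : (u + τ / 2).im = u.im + τ.im / 2 := by simp
    rw [this, abs_le]
    constructor <;> linarith
  have h4 := norm_jacobiTheta₂_term_le hτ him le_rfl n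
  have h5 := Real.exp_pos (-Real.pi * (τ.im * n ^ 2 - 2 * (S + τ.im) * |n|))
  nlinarith

lemma summable_muTerm {τ : ℂ} (hτ : 0 < τ.im) (u : ℂ) : Summable fun n ↦ muTerm τ n u := by
  obtain ⟨t, b, hb, h⟩ := exists_muTerm_bound hτ (|u.im| + 1)
  refine hb.of_norm_bounded_eventually ?_
  filter_upwards [t.finite_toSet.compl_mem_cofinite] with n hn
  exact (h u (by simp) n (by simpa using hn)).2

lemma differentiableAt_muTerm {τ u : ℂ} {n : ℤ} (h : 1 - e u * e τ ^ n ≠ 0) :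
    DifferentiableAt ℂ (muTerm τ n) u := by
  unfold muTerm
  fun_prop (disch := exact h)

lemma differentiableAt_tsum_muTerm {τ u : ℂ} (hτ : 0 < τ.im) (s : Finset ℤ)
    (hu : ∀ n ∉ s, 1 - e u * e τ ^ n ≠ 0) :
    DifferentiableAt ℂ (fun w ↦ ∑' n, if n ∈ s then 0 else muTerm τ n w) u := by
  obtain ⟨t, b, hb, h⟩ := exists_muTerm_bound hτ (|u.im| + 1)
  set V : Set ℂ := {w | |w.im| < |u.im| + 1}
  have hV : IsOpen V := isOpen_lt (by fun_prop) (by fun_prop)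
  have huV : u ∈ V := by simp [V]
  have htail : DifferentiableOn ℂ
      (fun w ↦ ∑' n : {n // n ∉ t}, if n.1 ∈ s then 0 else muTerm τ n w) V := by
    refine differentiableOn_tsum_of_summable_norm (hb.norm.subtype _) (fun n ↦ ?_) hV
      fun n w hw ↦ ?_
    · by_cases hn : n.1 ∈ s
      · simp [hn]
      · simp only [hn, if_false]
        exact fun w hw ↦ (differentiableAt_muTerm (h w hw n n.2).1).differentiableWithinAt
    · have := (h w hw n n.2).2
      split_ifs
      · simp
      · exact this.trans (le_abs_self _)
  have hhead : DifferentiableAt ℂ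
      (fun w ↦ ∑ n ∈ t, if n ∈ s then 0 else muTerm τ n w) u := by
    refine DifferentiableAt.fun_sum fun n _ ↦ ?_
    by_cases hn : n ∈ s
    · simp [hn]
    · simp only [hn, if_false]
      exact differentiableAt_muTerm (hu n hn)
  refine (hhead.add (htail.differentiableAt (hV.mem_nhds huV))).congr_of_eventuallyEq
    (.of_forall fun w ↦ ?_)
  have hsum : Summable fun n ↦ if n ∈ s then 0 else muTerm τ n w := by
    refine (summable_muTerm hτ w).norm.of_norm_bounded fun n ↦ ?_
    split_ifs <;> simp
  exact (hsum.sum_add_tsum_subtype_compl t).symm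

/-- The elliptic function `-4π² (q;q)_∞² x N(x) / θ(x)`, where `x = e u` and `N` is the
Appell–Lerch series of `zMu τ u u`. -/
def muElliptic (τ u : ℂ) : ℂ :=
  -4 * Real.pi ^ 2 * qpinf (e τ) (e τ) ^ 2 * e u * (∑' n, muTerm τ n u) / qtheta (e τ) (e u)

lemma muElliptic_eq {τ : ℂ} (hτ : 0 < τ.im) (u : ℂ) :
    4 * (Real.pi : ℂ) ^ 2 * Complex.I * e (τ / 8) * qpinf (e τ) (e τ) ^ 3 * zMu τ u u =
      muElliptic τ u := by
  have hQ := qpinf_self_ne_zero hτ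
  have h8 := e_ne_zero (τ / 8)
  have h2 := e_ne_zero (u / 2)
  have hu : e u = e (u / 2) * e (u / 2) := by rw [← e_add, add_halves]
  have hneg : e (-u / 2) = (e (u / 2))⁻¹ := by rw [neg_div, e_neg]
  change _ * (e (u / 2) / theta11 τ u * ∑' n, muTerm τ n u) = _
  rw [muElliptic, theta11, hneg]
  generalize qtheta (e τ) (e u) = T
  generalize ∑' n, muTerm τ n u = N
  rw [hu]
  field_simp

lemma muElliptic_add_one (τ u : ℂ) : muElliptic τ (u + 1) = muElliptic τ u := by
  simp only [muElliptic, muTerm_add_one, e_add, e_one, mul_one]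

lemma muElliptic_add {τ : ℂ} (hτ : 0 < τ.im) (u : ℂ) : muElliptic τ (u + τ) = muElliptic τ u := by
  have h0 := e_ne_zero u
  have h1 := e_ne_zero τ
  rw [muElliptic, muElliptic, qtheta_add hτ, ← (Equiv.subRight (1 : ℤ)).tsum_eq]
  simp only [Equiv.subRight_apply, muTerm_add, tsum_mul_left, e_add]
  field_simp

lemma muElliptic_neg {τ : ℂ} (hτ : 0 < τ.im) (u : ℂ) : muElliptic τ (-u) = muElliptic τ u := by
  have h0 := e_ne_zero u
  rw [muElliptic, muElliptic, qtheta_neg hτ, ← (Equiv.neg ℤ).tsum_eq]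
  simp only [Equiv.neg_apply, muTerm_neg, tsum_mul_left, e_neg]
  field_simp

lemma muElliptic_add_lattice {τ : ℂ} (hτ : 0 < τ.im) (u : ℂ) (m n : ℤ) :
    muElliptic τ (u + (m + n * τ)) = muElliptic τ u := by
  have h1 : Function.Periodic (muElliptic τ) 1 := muElliptic_add_one τ
  have h2 : Function.Periodic (muElliptic τ) τ := muElliptic_add hτ
  rw [← add_assoc, h2.int_mul n, ← mul_one (m : ℂ), h1.int_mul m]

lemma differentiableAt_muElliptic {τ u : ℂ} (hτ : 0 < τ.im) (hu : ∀ m n : ℤ, u ≠ m + n * τ) :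
    DifferentiableAt ℂ (muElliptic τ) u := by
  have h1 := differentiableAt_tsum_muTerm hτ ∅ (u := u)
    fun n _ ↦ one_sub_e_mul_zpow_ne_zero fun m ↦ hu m _
  simp only [Finset.notMem_empty, if_false] at h1
  have h2 := (differentiable_qtheta_e hτ) u
  have h3 := qtheta_e_ne_zero hτ hu
  unfold muElliptic
  fun_prop (disch := exact h3)

lemma hasDerivAt_e_zero : HasDerivAt e (2 * Real.pi * I) 0 := by
  have := ((hasDerivAt_id (0 : ℂ)).const_mul (2 * Real.pi * I)).cexp
  simp only [id_eq, mul_zero, Complex.exp_zero, one_mul, mul_one] at this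
  exact this

lemma tendsto_div_one_sub_e :
    Tendsto (fun u ↦ u / (1 - e u)) (𝓝[≠] 0) (𝓝 (-(2 * Real.pi * I)⁻¹)) := by
  have h2 := ((hasDerivAt_iff_tendsto_slope.1 hasDerivAt_e_zero).inv₀ (by simp [Real.pi_ne_zero])).neg
  refine h2.congr fun u ↦ ?_
  rw [slope_def_field, e_zero, sub_zero, inv_div, ← neg_sub 1, div_neg, neg_neg]

lemma tendsto_sq_mul_muElliptic {τ : ℂ} (hτ : 0 < τ.im) :
    Tendsto (fun u ↦ u ^ 2 * muElliptic τ u) (𝓝[≠] 0) (𝓝 1) := by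
  have hQ := qpinf_self_ne_zero hτ
  set Q := qpinf (e τ) (e τ) with hQdef
  set N : ℂ → ℂ := fun w ↦ ∑' n, if n ∈ ({0} : Finset ℤ) then 0 else muTerm τ n w with hN
  set R : ℂ → ℂ := fun u ↦ qpinf (e (u + τ)) (e τ) * qpinf (e (τ - u)) (e τ) with hR
  have hNc : ContinuousAt N 0 := by
    refine (differentiableAt_tsum_muTerm hτ {0} fun n hn ↦
      one_sub_e_mul_zpow_ne_zero fun m h ↦ ?_).continuousAt
    have := congrArg Complex.im h
    simp [hτ.ne'] at this
    simp [this] at hn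
  have hRc : ContinuousAt R 0 := by
    have h := (differentiable_qpinf (norm_e_lt_one hτ)).continuous
    have he := differentiable_e.continuous
    have h1 : Continuous fun u ↦ qpinf (e (u + τ)) (e τ) :=
      h.comp (f := fun u ↦ e (u + τ)) (by fun_prop)
    have h2 : Continuous fun u ↦ qpinf (e (τ - u)) (e τ) :=
      h.comp (f := fun u ↦ e (τ - u)) (by fun_prop)
    exact (h1.mul h2).continuousAt
  have hR0 : R 0 = Q ^ 2 := by simp [hR, hQdef, sq]
  have he : ContinuousAt e 0 := differentiable_e.continuous.continuousAt
  have hc : ContinuousAt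
      (fun u ↦ -4 * Real.pi ^ 2 * Q ^ 2 * e u * (1 + (1 - e u) * N u) / R u) 0 := by
    have : R 0 ≠ 0 := by simp [hR0, hQ]
    fun_prop (disch := exact this)
  have hlim := (hc.tendsto.mono_left (nhdsWithin_le_nhds (s := {0}ᶜ))).mul
    (tendsto_div_one_sub_e.pow 2)
  have hval : -4 * Real.pi ^ 2 * Q ^ 2 * e 0 * (1 + (1 - e 0) * N 0) / R 0 *
      (-(2 * Real.pi * I)⁻¹) ^ 2 = 1 := by
    have hpi : (Real.pi : ℂ) ≠ 0 := by simp [Real.pi_ne_zero]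
    rw [hR0, e_zero]
    field_simp
    rw [I_sq]
    ring
  rw [hval] at hlim
  refine hlim.congr' ?_
  have hev : ∀ᶠ u in 𝓝[≠] (0 : ℂ), 1 - e u ≠ 0 := by
    filter_upwards [hasDerivAt_e_zero.eventually_ne (c := 1) (by simp [Real.pi_ne_zero])] with u hu
    exact sub_ne_zero.2 hu.symm
  filter_upwards [hev] with u hu
  have hsum : ∑' n, muTerm τ n u = (1 - e u)⁻¹ + N u := by
    rw [(summable_muTerm hτ u).tsum_eq_add_tsum_ite 0]
    simp [muTerm, hN, e_zero]
  rw [muElliptic, hsum, qtheta_e_eq hτ, ← hQdef]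
  change _ = u ^ 2 * (_ / ((1 - e u) * R u))
  field_simp

theorem stmt17 (τ : ℂ) (hτ : 0 < τ.im) (u v : ℂ)
    (hu : ∀ m n : ℤ, u ≠ (m : ℂ) + (n : ℂ) * τ)
    (hv : ∀ m n : ℤ, v ≠ (m : ℂ) + (n : ℂ) * τ) :
    wp τ u - wp τ v =
      4 * (Real.pi : ℂ) ^ 2 * Complex.I * e (τ / 8) * qpinf (e τ) (e τ) ^ 3 * zMu τ u u
      - 4 * (Real.pi : ℂ) ^ 2 * Complex.I * e (τ / 8) * qpinf (e τ) (e τ) ^ 3 * zMu τ v v := by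
  set L := (periodPairOne τ hτ).lattice
  have hmem : ∀ {w : ℂ}, w ∉ L → ∀ m n : ℤ, w ≠ m + n * τ := fun hw m n h ↦
    hw ((mem_lattice_periodPairOne hτ).2 ⟨m, n, h⟩)
  have key := (periodPairOne τ hτ).apply_eq_apply_of_even (u := u) (v := v)
    (G := fun w ↦ wp τ w - muElliptic τ w) (fun w hw ↦ ?_) (fun w hw l hl ↦ ?_) (fun w hw ↦ ?_) ?_
    (fun h ↦ ?_) (fun h ↦ ?_)
  · rw [muElliptic_eq hτ, muElliptic_eq hτ]
    linear_combination key
  · refine DifferentiableAt.sub ?_ (differentiableAt_muElliptic hτ (hmem hw))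
    rw [show wp τ = _ from funext (wp_eq_weierstrassP τ hτ)]
    exact (periodPairOne τ hτ).differentiableOn_weierstrassP.differentiableAt
      ((periodPairOne τ hτ).isClosed_lattice.isOpen_compl.mem_nhds hw)
  · obtain ⟨m, n, h⟩ := (mem_lattice_periodPairOne hτ).1 hl
    have h1 := (periodPairOne τ hτ).weierstrassP_add_coe w ⟨l, hl⟩
    simp only [wp_eq_weierstrassP τ hτ]
    rw [h1, h, muElliptic_add_lattice hτ]
  · simp only [wp_eq_weierstrassP τ hτ]
    rw [PeriodPair.weierstrassP_neg, muElliptic_neg hτ]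
  · simpa [mul_sub] using (tendsto_sq_mul_wp τ hτ).sub (tendsto_sq_mul_muElliptic hτ)
  · obtain ⟨m, n, h⟩ := (mem_lattice_periodPairOne hτ).1 h
    exact hu m n h
  · obtain ⟨m, n, h⟩ := (mem_lattice_periodPairOne hτ).1 h
    exact hv m n h
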